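/- Assume f is continuous and has all continuous partial derivatives up to order six on D_M, assume conditions (i)–(iii) of the existence theorem hold, and let φ_k, w_k, v_k, u_k be the functions constructed by the continuous iteration (each solving its Poisson problem classically). Then for every k ≥ 0: w_k is six times continuously differentiable in Ω, v_k is eight times continuously differentiable in Ω, and u_k is ten times continuously differentiable in Ω. -/

import Mathlib

open scoped BigOperators

/-- The Laplace operator on `ℝⁿ` (realized as `EuclideanSpace ℝ (Fin n)`):
`Δ f x = ∑ i ∂²f/∂xᵢ² (x)`. -/
noncomputable def lap {n : ℕ} (f : EuclideanSpace ℝ (Fin n) → ℝ)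
    (x : EuclideanSpace ℝ (Fin n)) : ℝ :=
  ∑ i : Fin n, fderiv ℝ (fun y => fderiv ℝ f y (EuclideanSpace.single i 1)) x
    (EuclideanSpace.single i 1)

/-- `max_{x ∈ S} |y x|` (as a supremum). -/
noncomputable def supNorm {α : Type*} (S : Set α) (y : α → ℝ) : ℝ :=
  sSup ((fun x => |y x|) '' S)

/-- `u` is a classical solution of the triharmonic problem `Δ³u = φ` in `Ω`,
`u = Δu = Δ²u = 0` on `Γ = ∂Ω`, with `u`, `Δu`, `Δ²u` continuous on `Ω̄`. -/
def IsClassicalTriharm {n : ℕ} (Ω : Set (EuclideanSpace ℝ (Fin n)))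
    (u φ : EuclideanSpace ℝ (Fin n) → ℝ) : Prop :=
  ContinuousOn u (closure Ω) ∧ ContinuousOn (lap u) (closure Ω) ∧
  ContinuousOn (lap (lap u)) (closure Ω) ∧
  ContDiffOn ℝ 2 u Ω ∧ ContDiffOn ℝ 2 (lap u) Ω ∧ ContDiffOn ℝ 2 (lap (lap u)) Ω ∧
  (∀ x ∈ Ω, lap (lap (lap u)) x = φ x) ∧
  (∀ x ∈ frontier Ω, u x = 0 ∧ lap u x = 0 ∧ lap (lap u) x = 0)

/-- `u` is a (classical) solution of problem (P):
`Δ³u = f(x, u, Δu, Δ²u)` in `Ω`, `u = Δu = Δ²u = 0` on `Γ = ∂Ω`. -/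
def IsSolP {n : ℕ} (Ω : Set (EuclideanSpace ℝ (Fin n)))
    (f : EuclideanSpace ℝ (Fin n) → ℝ → ℝ → ℝ → ℝ)
    (u : EuclideanSpace ℝ (Fin n) → ℝ) : Prop :=
  IsClassicalTriharm Ω u (fun x => f x (u x) (lap u x) (lap (lap u) x))

/-- `w` is a classical solution of the Poisson problem `Δw = φ` in `Ω`, `w = 0` on `∂Ω`. -/
def IsPoissonSol {n : ℕ} (Ω : Set (EuclideanSpace ℝ (Fin n)))
    (w φ : EuclideanSpace ℝ (Fin n) → ℝ) : Prop :=
  ContinuousOn w (closure Ω) ∧ ContDiffOn ℝ 2 w Ω ∧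
  (∀ x ∈ Ω, lap w x = φ x) ∧ (∀ x ∈ frontier Ω, w x = 0)

section Reg

open MeasureTheory Set Filter Topology
open scoped ContDiff

set_option linter.unusedSectionVars false

/-- scaled averages -/
noncomputable def av {E : Type} [NormedAddCommGroup E] [NormedSpace ℝ E] [FiniteDimensional ℝ E]
    [MeasureSpace E] [BorelSpace E]
    {W V X : Type} [NormedAddCommGroup W] [NormedSpace ℝ W]
    [NormedAddCommGroup V] [NormedSpace ℝ V] [NormedAddCommGroup X] [NormedSpace ℝ X]
    (L : W →L[ℝ] V →L[ℝ] X) (g : E → W)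
    (Θ : E → V) (t : ℝ) (x : E) : X :=
  ∫ y, L (g (x - t • y)) (Θ y)

variable {E : Type} [NormedAddCommGroup E] [NormedSpace ℝ E] [FiniteDimensional ℝ E]
    [MeasureSpace E] [BorelSpace E]
    [(volume : Measure E).IsAddHaarMeasure]
    {W V X : Type} [NormedAddCommGroup W] [NormedSpace ℝ W]
    [NormedAddCommGroup V] [NormedSpace ℝ V] [NormedAddCommGroup X] [NormedSpace ℝ X]

theorem av_bd (L : W →L[ℝ] V →L[ℝ] X) {g : E → W}
    (Θ : E → V) {B : ℝ} (hB : ∀ x, ‖g x‖ ≤ B) (x y : E) :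
    ‖L (g x) (Θ y)‖ ≤ ‖L‖ * B * ‖Θ y‖ := by
  refine (L.le_opNorm₂ _ _).trans ?_
  gcongr
  exact hB x

theorem av_bd2 (L : W →L[ℝ] V →L[ℝ] X) {g : E → W}
    (Θ : E → V) {B : ℝ} (hB : ∀ x, ‖g x‖ ≤ B) :
    ∃ K, ∀ x y, ‖L (g x) (Θ y)‖ ≤ K * ‖Θ y‖ :=
  ⟨_, fun x y => av_bd L Θ hB x y⟩

theorem av_cont (L : W →L[ℝ] V →L[ℝ] X) {g : E → W}
    {Θ : E → V} (hg : Continuous g) (hgc : HasCompactSupport g)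
    (hΘ : Continuous Θ) (hΘc : HasCompactSupport Θ) :
    Continuous (fun p : E × ℝ => av L g Θ p.2 p.1) := by
  obtain ⟨B, hB⟩ := hg.bounded_above_of_compact_support hgc
  unfold av
  refine continuous_of_dominated (bound := fun y => ‖L‖ * B * ‖Θ y‖) ?_ ?_ ?_ ?_
  · intro p
    apply Continuous.aestronglyMeasurable
    fun_prop
  · intro p
    exact Eventually.of_forall fun y => av_bd L Θ hB _ _
  · exact (hΘ.integrable_of_hasCompactSupport hΘc).norm.const_mul _
  · exact Eventually.of_forall fun y => by fun_prop

theorem av_bound (L : W →L[ℝ] V →L[ℝ] X) {g : E → W}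
    {Θ : E → V} (hg : Continuous g) (hgc : HasCompactSupport g)
    (hΘ : Continuous Θ) (hΘc : HasCompactSupport Θ) :
    ∃ C, 0 ≤ C ∧ ∀ t x, ‖av L g Θ t x‖ ≤ C := by
  obtain ⟨B, hB⟩ := hg.bounded_above_of_compact_support hgc
  have hC : ∀ t x, ‖av L g Θ t x‖ ≤ ∫ y, ‖L‖ * B * ‖Θ y‖ := by
    intro t x
    exact norm_integral_le_of_norm_le ((hΘ.integrable_of_hasCompactSupport hΘc).norm.const_mul _)
      (Eventually.of_forall fun y => av_bd L Θ hB _ _)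
  exact ⟨_, (norm_nonneg _).trans (hC 0 0), hC⟩

theorem av_eq_conv (L : W →L[ℝ] V →L[ℝ] X) (g : E → W)
    (Θ : E → V) {t : ℝ} (ht : t ≠ 0) (x : E) :
    av L g Θ t x = (convolution Θ (fun z => g (t • z)) L.flip volume) (t⁻¹ • x) := by
  unfold av convolution
  congr 1
  ext y
  simp [smul_sub, smul_smul, ht]

theorem av_deriv_kernel (L : W →L[ℝ] V →L[ℝ] X) {g : E → W}
    {Θ : E → V} (hg : Continuous g)
    (hΘ : ContDiff ℝ 1 Θ) (hΘc : HasCompactSupport Θ) {t : ℝ} (ht : t ≠ 0)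
    (x : E) :
    HasFDerivAt (av L g Θ t)
      (t⁻¹ • av (L.precompR E) g (fderiv ℝ Θ) t x) x := by
  have h1 : av L g Θ t = fun x => (convolution Θ (fun z => g (t • z)) L.flip volume) (t⁻¹ • x) :=
    funext fun x => av_eq_conv L g Θ ht x
  have hG : Continuous (fun z => g (t • z)) := by fun_prop
  have h2 := hΘc.hasFDerivAt_convolution_left (μ := volume) L.flip hΘ
    (hG.locallyIntegrable) (t⁻¹ • x)
  have h3 : HasFDerivAt (fun x : E => t⁻¹ • x)
    (t⁻¹ • ContinuousLinearMap.id ℝ E) x :=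
    (hasFDerivAt_id x).const_smul t⁻¹
  have h4 := h2.comp x h3
  rw [h1]
  refine h4.congr_fderiv ?_
  rw [av_eq_conv _ _ _ ht, ContinuousLinearMap.comp_smul, ContinuousLinearMap.comp_id]
  rfl

theorem av_smooth (L : W →L[ℝ] V →L[ℝ] X) {g : E → W}
    {Θ : E → V} (hg : Continuous g)
    (hΘ : ContDiff ℝ ∞ Θ) (hΘc : HasCompactSupport Θ) {t : ℝ} (ht : t ≠ 0) :
    ContDiff ℝ ∞ (av L g Θ t) := by
  have h1 : av L g Θ t = fun x => (convolution Θ (fun z => g (t • z)) L.flip volume) (t⁻¹ • x) :=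
    funext fun x => av_eq_conv L g Θ ht x
  have hG : Continuous (fun z => g (t • z)) := by fun_prop
  rw [h1]
  have := hΘc.contDiff_convolution_left (μ := volume) L.flip hΘ (hG.locallyIntegrable)
  exact this.comp (by fun_prop)

theorem av_deriv_g (L : W →L[ℝ] V →L[ℝ] X) {g : E → W}
    {Θ : E → V} (hg : ContDiff ℝ 1 g) (hgc : HasCompactSupport g)
    (hΘ : Continuous Θ) (hΘc : HasCompactSupport Θ) {t : ℝ}
    (x : E) :
    HasFDerivAt (av L g Θ t)
      (av (L.precompL E) (fderiv ℝ g) Θ t x) x := by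
  have hg0 := hg.continuous
  have hg1 : Continuous (fderiv ℝ g) := hg.continuous_fderiv (by norm_num)
  obtain ⟨B, hB⟩ := hg0.bounded_above_of_compact_support hgc
  obtain ⟨B1, hB1⟩ := hg1.bounded_above_of_compact_support (hgc.fderiv ℝ)
  obtain ⟨K, hK⟩ := av_bd2 (L.precompL E) Θ hB1
  have hint := (hΘ.integrable_of_hasCompactSupport hΘc (μ := volume)).norm
  unfold av
  refine hasFDerivAt_integral_of_dominated_of_fderiv_le (s := univ)
    (F := fun x y => L (g (x - t • y)) (Θ y))
    (F' := fun x y => L.precompL E (fderiv ℝ g (x - t • y)) (Θ y))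
    (bound := fun y => K * ‖Θ y‖)
    univ_mem ?_ ?_ ?_ ?_ ?_ ?_
  · exact Eventually.of_forall fun x => Continuous.aestronglyMeasurable (by fun_prop)
  · exact (hint.const_mul (‖L‖ * B)).mono' (Continuous.aestronglyMeasurable (by fun_prop))
      (Eventually.of_forall fun y => av_bd L Θ hB _ _)
  · exact Continuous.aestronglyMeasurable (by fun_prop)
  · exact Eventually.of_forall fun y x _ => hK _ _
  · exact hint.const_mul _
  · refine Eventually.of_forall fun y x _ => ?_
    have h1 : HasFDerivAt (fun x => g (x - t • y)) (fderiv ℝ g (x - t • y)) x := by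
      have := (hg.differentiable (by norm_num) (x - t • y)).hasFDerivAt.comp x
        ((hasFDerivAt_id x).sub_const (t • y))
      exact this
    have h2 := (L.flip (Θ y)).hasFDerivAt.comp x h1
    exact h2

/-- time integrated averages -/
noncomputable def Sv {E : Type} [NormedAddCommGroup E] [NormedSpace ℝ E] [FiniteDimensional ℝ E]
    [MeasureSpace E] [BorelSpace E]
    {W V X : Type} [NormedAddCommGroup W] [NormedSpace ℝ W]
    [NormedAddCommGroup V] [NormedSpace ℝ V] [NormedAddCommGroup X] [NormedSpace ℝ X]
    (L : W →L[ℝ] V →L[ℝ] X) (g : E → W)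
    (Θ : E → V) (T : ℝ) (j : ℕ) (x : E) : X :=
  ∫ t in (0 : ℝ)..T, t ^ j • av L g Θ t x

theorem Sv_cont (L : W →L[ℝ] V →L[ℝ] X) {g : E → W}
    {Θ : E → V} (hg : Continuous g) (hgc : HasCompactSupport g)
    (hΘ : Continuous Θ) (hΘc : HasCompactSupport Θ) (T : ℝ) (j : ℕ) :
    Continuous (Sv L g Θ T j) := by
  unfold Sv
  have := av_cont L hg hgc hΘ hΘc
  apply intervalIntegral.continuous_parametric_intervalIntegral_of_continuous'
  exact (continuous_snd.pow j).smul this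

theorem Sv_deriv {W' V' : Type} [NormedAddCommGroup W'] [NormedSpace ℝ W']
    [NormedAddCommGroup V'] [NormedSpace ℝ V']
    (L : W →L[ℝ] V →L[ℝ] X) {g : E → W}
    {Θ : E → V} (hg : Continuous g) (hgc : HasCompactSupport g)
    (hΘ : Continuous Θ) (hΘc : HasCompactSupport Θ)
    (L' : W' →L[ℝ] V' →L[ℝ] (E →L[ℝ] X)) {g' : E → W'}
    {Θ' : E → V'} (hg' : Continuous g') (hgc' : HasCompactSupport g')
    (hΘ' : Continuous Θ') (hΘc' : HasCompactSupport Θ')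
    {T : ℝ} (hT : 0 < T) (j j' : ℕ)
    (hd : ∀ t, 0 < t → ∀ x, HasFDerivAt (fun x => t ^ j • av L g Θ t x)
      (t ^ j' • av L' g' Θ' t x) x) (x : E) :
    HasFDerivAt (Sv L g Θ T j) (Sv L' g' Θ' T j' x) x := by
  have h1 := av_cont L hg hgc hΘ hΘc
  have h2 := av_cont L' hg' hgc' hΘ' hΘc'
  obtain ⟨C, hC0, hC⟩ := av_bound L' hg' hgc' hΘ' hΘc'
  have c1 : ∀ x, Continuous (fun t : ℝ => t ^ j • av L g Θ t x) := fun x =>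
    (continuous_id.pow j).smul (h1.comp (Continuous.prodMk_right x))
  have c2 : ∀ x, Continuous (fun t : ℝ => t ^ j' • av L' g' Θ' t x) := fun x =>
    (continuous_id.pow j').smul (h2.comp (Continuous.prodMk_right x))
  unfold Sv
  refine intervalIntegral.hasFDerivAt_integral_of_dominated_of_fderiv_le (s := univ)
    (bound := fun t => T ^ j' * C)
    (F := fun x t => t ^ j • av L g Θ t x) (F' := fun x t => t ^ j' • av L' g' Θ' t x)
    univ_mem ?_ ?_ ?_ ?_ ?_ ?_
  · exact Eventually.of_forall fun x => (c1 x).aestronglyMeasurable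
  · exact (c1 x).intervalIntegrable _ _
  · exact (c2 x).aestronglyMeasurable
  · refine Eventually.of_forall fun t ht x _ => ?_
    rw [uIoc_of_le hT.le] at ht
    rw [norm_smul, norm_pow, Real.norm_eq_abs, abs_of_pos ht.1]
    have := ht.1.le
    gcongr
    · exact ht.2
    · exact hC t x
  · exact intervalIntegrable_const
  · refine Eventually.of_forall fun t ht x _ => ?_
    rw [uIoc_of_le hT.le] at ht
    exact hd t ht.1 x

theorem Sv_zero_contDiff (m : ℕ) {T : ℝ} (hT : 0 < T) :
    ∀ {W V X : Type} [NormedAddCommGroup W] [NormedSpace ℝ W]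
    [NormedAddCommGroup V] [NormedSpace ℝ V] [NormedAddCommGroup X] [NormedSpace ℝ X]
    (L : W →L[ℝ] V →L[ℝ] X) {g : E → W}
    {Θ : E → V} (_ : ContDiff ℝ m g) (_ : HasCompactSupport g)
    (_ : Continuous Θ) (_ : HasCompactSupport Θ), ContDiff ℝ m (Sv L g Θ T 0) := by
  induction m with
  | zero =>
    intro W V X _ _ _ _ _ _ L g Θ hg hgc hΘ hΘc
    exact contDiff_zero.2 (Sv_cont L hg.continuous hgc hΘ hΘc T 0)
  | succ m ih =>
    intro W V X _ _ _ _ _ _ L g Θ hg hgc hΘ hΘc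
    have hg1 : ContDiff ℝ 1 g := hg.of_le (by simp)
    have hg' : ContDiff ℝ m (fderiv ℝ g) := hg.fderiv_right (by simp)
    push_cast
    rw [contDiff_succ_iff_hasFDerivAt]
    refine ⟨_, ih (L.precompL _) hg' (hgc.fderiv ℝ) hΘ hΘc, fun x => ?_⟩
    refine Sv_deriv L hg.continuous hgc hΘ hΘc _ hg'.continuous (hgc.fderiv ℝ) hΘ hΘc hT 0 0 ?_ x
    intro t _ x
    simpa using av_deriv_g L hg1 hgc hΘ hΘc x

theorem Sv_contDiff (m j : ℕ) {T : ℝ} (hT : 0 < T) :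
    ∀ {W V X : Type} [NormedAddCommGroup W] [NormedSpace ℝ W]
    [NormedAddCommGroup V] [NormedSpace ℝ V] [NormedAddCommGroup X] [NormedSpace ℝ X]
    (L : W →L[ℝ] V →L[ℝ] X) {g : E → W}
    {Θ : E → V} (_ : ContDiff ℝ m g) (_ : HasCompactSupport g)
    (_ : ContDiff ℝ ∞ Θ) (_ : HasCompactSupport Θ), ContDiff ℝ (m + j : ℕ) (Sv L g Θ T j) := by
  induction j with
  | zero =>
    intro W V X _ _ _ _ _ _ L g Θ hg hgc hΘ hΘc
    exact Sv_zero_contDiff m hT L hg hgc hΘ.continuous hΘc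
  | succ j ih =>
    intro W V X _ _ _ _ _ _ L g Θ hg hgc hΘ hΘc
    have hΘ' : ContDiff ℝ ∞ (fderiv ℝ Θ) := hΘ.fderiv_right (by simp)
    rw [← add_assoc]
    push_cast
    have := contDiff_succ_iff_hasFDerivAt (𝕜 := ℝ) (f := Sv L g Θ T (j + 1)) (n := m + j)
    push_cast at this
    rw [this]
    have ih' := ih (L.precompR E) hg hgc hΘ' (hΘc.fderiv ℝ)
    push_cast at ih'
    refine ⟨_, ih', fun x => ?_⟩
    refine Sv_deriv L hg.continuous hgc hΘ.continuous hΘc _ hg.continuous hgc hΘ'.continuous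
      (hΘc.fderiv ℝ) hT (j + 1) j ?_ x
    intro t ht x
    have := (av_deriv_kernel L hg.continuous (hΘ.of_le (by simp)) hΘc ht.ne' x).const_smul
      (t ^ (j + 1))
    refine this.congr_fderiv ?_
    rw [smul_smul, pow_succ, mul_assoc, mul_inv_cancel₀ ht.ne', mul_one]


/-- abbreviation for the multiplication map -/
noncomputable abbrev ml : ℝ →L[ℝ] ℝ →L[ℝ] ℝ := ContinuousLinearMap.mul ℝ ℝ

theorem euc_sum {n : ℕ} (A : EuclideanSpace ℝ (Fin n) →L[ℝ] ℝ) (y : EuclideanSpace ℝ (Fin n)) :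
    A y = ∑ i, y i * A (EuclideanSpace.single i 1) := by
  have h : y = ∑ i, y i • EuclideanSpace.single i (1 : ℝ) := by
    ext j
    simp [Finset.sum_apply, Pi.single_apply]
  conv_lhs => rw [h]
  simp [map_sum]

theorem lap_cont {n : ℕ} {h : EuclideanSpace ℝ (Fin n) → ℝ} (hh : ContDiff ℝ 2 h) :
    Continuous (lap h) := by
  unfold lap
  refine continuous_finsetSum _ fun i _ => ?_
  have h1 : ContDiff ℝ 1 (fderiv ℝ h) := hh.fderiv_right (by norm_num)
  have h2 : ContDiff ℝ 1 (fun y => fderiv ℝ h y (EuclideanSpace.single i 1)) :=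
    h1.clm_apply contDiff_const
  exact (h2.continuous_fderiv (by norm_num)).clm_apply continuous_const

theorem lap_supp {n : ℕ} {h : EuclideanSpace ℝ (Fin n) → ℝ} (hc : HasCompactSupport h) :
    HasCompactSupport (lap h) := by
  refine hc.of_isClosed_subset (isClosed_tsupport _) ?_
  refine closure_minimal ?_ (isClosed_tsupport _)
  intro x hx
  by_contra hx'
  apply hx
  have h0 : h =ᶠ[𝓝 x] fun _ => 0 := notMem_tsupport_iff_eventuallyEq.1 hx'
  unfold lap
  refine Finset.sum_eq_zero fun i _ => ?_
  have h1 : (fun y => fderiv ℝ h y (EuclideanSpace.single i 1)) =ᶠ[𝓝 x] fun _ => 0 := by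
    have := h0.fderiv (𝕜 := ℝ)
    filter_upwards [this] with y hy
    rw [hy]; simp
  rw [h1.fderiv_eq]
  simp

theorem lap_congr {n : ℕ} {h h' : EuclideanSpace ℝ (Fin n) → ℝ} {x : EuclideanSpace ℝ (Fin n)}
    (h0 : h =ᶠ[𝓝 x] h') : lap h x = lap h' x := by
  unfold lap
  refine Finset.sum_congr rfl fun i _ => ?_
  have h1 : (fun y => fderiv ℝ h y (EuclideanSpace.single i 1)) =ᶠ[𝓝 x]
      (fun y => fderiv ℝ h' y (EuclideanSpace.single i 1)) := by
    have := h0.fderiv (𝕜 := ℝ)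
    filter_upwards [this] with y hy
    rw [hy]
  rw [h1.fderiv_eq]

theorem av_time_aux {n : ℕ} {h Θ : EuclideanSpace ℝ (Fin n) → ℝ}
    (hh : ContDiff ℝ 1 h) (hc : HasCompactSupport h)
    (hΘ : Continuous Θ) (hΘc : HasCompactSupport Θ) (x : EuclideanSpace ℝ (Fin n)) (t : ℝ) :
    HasDerivAt (fun t => av ml h Θ t x) (∫ y, -(fderiv ℝ h (x - t • y) y) * Θ y) t := by
  have hg0 := hh.continuous
  have hg1 : Continuous (fderiv ℝ h) := hh.continuous_fderiv (by norm_num)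
  obtain ⟨B, hB⟩ := hg1.bounded_above_of_compact_support (hc.fderiv ℝ)
  have hcs : ∀ k : EuclideanSpace ℝ (Fin n) → ℝ, HasCompactSupport (fun y => k y * Θ y) :=
    fun k => hΘc.mul_left
  unfold av
  refine (hasDerivAt_integral_of_dominated_loc_of_deriv_le (s := univ)
    (F := fun t y => h (x - t • y) * Θ y)
    (F' := fun t y => -(fderiv ℝ h (x - t • y) y) * Θ y)
    (bound := fun y => B * ‖y‖ * ‖Θ y‖) univ_mem ?_ ?_ ?_ ?_ ?_ ?_).2
  · exact Eventually.of_forall fun x => Continuous.aestronglyMeasurable (by fun_prop)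
  · exact Continuous.integrable_of_hasCompactSupport (by fun_prop) (hcs _)
  · exact Continuous.aestronglyMeasurable (by fun_prop)
  · refine Eventually.of_forall fun y t _ => ?_
    rw [norm_mul, norm_neg]
    gcongr
    refine (ContinuousLinearMap.le_opNorm _ _).trans ?_
    gcongr
    exact hB _
  · exact Continuous.integrable_of_hasCompactSupport (by fun_prop) hΘc.norm.mul_left
  · refine Eventually.of_forall fun y t _ => ?_
    have h1 : HasDerivAt (fun t : ℝ => x - t • y) (-y) t := by
      simpa using ((hasDerivAt_id t).smul_const y).const_sub x
    have h2 := (hh.differentiable (by norm_num) (x - t • y)).hasFDerivAt.comp_hasDerivAt t h1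
    have h3 := h2.mul_const (Θ y)
    simpa using h3

theorem av_time {n : ℕ} {h Θ Θ1 : EuclideanSpace ℝ (Fin n) → ℝ}
    (hh : ContDiff ℝ 2 h) (hc : HasCompactSupport h)
    (hΘ : Continuous Θ) (hΘc : HasCompactSupport Θ)
    (hΘ1 : ContDiff ℝ 1 Θ1) (hTOne : HasCompactSupport Θ1)
    (hrel : ∀ y i, y i * Θ y = fderiv ℝ Θ1 y (EuclideanSpace.single i 1))
    (x : EuclideanSpace ℝ (Fin n)) (t : ℝ) :
    HasDerivAt (fun t => av ml h Θ t x) (-(t * av ml (lap h) Θ1 t x)) t := by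
  have key := av_time_aux (hh.of_le (by norm_num)) hc hΘ hΘc x t
  convert key using 1
  have hd1 : ContDiff ℝ 1 (fderiv ℝ h) := hh.fderiv_right (by norm_num)
  have hdi : ∀ i : Fin n, ContDiff ℝ 1 (fun y => fderiv ℝ h y (EuclideanSpace.single i 1)) :=
    fun i => hd1.clm_apply contDiff_const
  have hΘ1' : Continuous (fderiv ℝ Θ1) := hΘ1.continuous_fderiv (by norm_num)
  have hc1 := hΘ1.continuous
  have ibp : ∀ i : Fin n,
      ∫ y, fderiv ℝ h (x - t • y) (EuclideanSpace.single i 1) *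
        fderiv ℝ Θ1 y (EuclideanSpace.single i 1) =
      t * ∫ y, fderiv ℝ (fun y => fderiv ℝ h y (EuclideanSpace.single i 1)) (x - t • y)
        (EuclideanSpace.single i 1) * Θ1 y := by
    intro i
    set e : EuclideanSpace ℝ (Fin n) := EuclideanSpace.single i 1 with he
    set k : EuclideanSpace ℝ (Fin n) → ℝ := fun y => fderiv ℝ h y e with hk
    have hkd : ContDiff ℝ 1 k := hdi i
    have hkc : Continuous k := hkd.continuous
    have hk' : Continuous (fderiv ℝ k) := hkd.continuous_fderiv (by norm_num)
    have hcomp : ∀ y, HasFDerivAt (fun y => k (x - t • y)) (-(t • fderiv ℝ k (x - t • y))) y := by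
      intro y
      have h1 : HasFDerivAt (fun y : EuclideanSpace ℝ (Fin n) => x - t • y)
          (-(t • ContinuousLinearMap.id ℝ (EuclideanSpace ℝ (Fin n)))) y :=
        ((hasFDerivAt_id y).const_smul t).const_sub x
      have h2 := (hkd.differentiable (by norm_num) (x - t • y)).hasFDerivAt.comp y h1
      refine h2.congr_fderiv ?_
      ext v
      simp
    have hfe : ∀ y, fderiv ℝ (fun y => k (x - t • y)) y e = -(t * fderiv ℝ k (x - t • y) e) := by
      intro y
      rw [(hcomp y).fderiv]
      simp
    have hcs : HasCompactSupport (fun y => fderiv ℝ Θ1 y e) :=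
      (hTOne.fderiv ℝ).comp_left (g := fun A : EuclideanSpace ℝ (Fin n) →L[ℝ] ℝ => A e) (by simp)
    have := integral_mul_fderiv_eq_neg_fderiv_mul_of_integrable (μ := volume)
      (f := fun y => k (x - t • y)) (g := Θ1) (v := e) ?_ ?_ ?_ ?_ ?_
    · rw [this, ← integral_const_mul, ← integral_neg]
      congr 1
      ext y
      rw [hfe]
      ring
    · simp_rw [hfe]
      exact Continuous.integrable_of_hasCompactSupport (by fun_prop) hTOne.mul_left
    · exact Continuous.integrable_of_hasCompactSupport (by fun_prop) hcs.mul_left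
    · exact Continuous.integrable_of_hasCompactSupport (by fun_prop) hTOne.mul_left
    · intro y _
      exact (hcomp y).differentiableAt
    · intro y _
      exact hΘ1.differentiable (by norm_num) y
  have e1 : ∀ y, -(fderiv ℝ h (x - t • y) y) * Θ y =
      ∑ i, -(fderiv ℝ h (x - t • y) (EuclideanSpace.single i 1) *
        fderiv ℝ Θ1 y (EuclideanSpace.single i 1)) := by
    intro y
    rw [euc_sum (fderiv ℝ h (x - t • y)) y, ← Finset.sum_neg_distrib, Finset.sum_mul]
    refine Finset.sum_congr rfl fun i _ => ?_
    rw [← hrel y i]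
    ring
  simp_rw [e1]
  have hd0 := hd1.continuous
  rw [integral_finsetSum]
  · simp_rw [integral_neg, ibp]
    rw [Finset.sum_neg_distrib, ← Finset.mul_sum, ← integral_finsetSum]
    · congr 2
      unfold av lap
      congr 1
      ext y
      simp
    · intro i _
      have hk' := (hdi i).continuous_fderiv (by norm_num)
      exact Continuous.integrable_of_hasCompactSupport (by fun_prop) hTOne.mul_left
  · intro i _
    have hcs : HasCompactSupport (fun y => fderiv ℝ Θ1 y (EuclideanSpace.single i 1)) :=
      (hTOne.fderiv ℝ).comp_left (g := fun A : EuclideanSpace ℝ (Fin n) →L[ℝ] ℝ =>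
        A (EuclideanSpace.single i 1)) (by simp)
    exact (Continuous.integrable_of_hasCompactSupport (by fun_prop) hcs.mul_left).neg

theorem antider {θ : ℝ → ℝ} (hθ : ContDiff ℝ ∞ θ) (h0 : ∀ s, 1 ≤ s → θ s = 0) :
    ∃ η : ℝ → ℝ, ContDiff ℝ ∞ η ∧ (∀ s, 1 ≤ s → η s = 0) ∧ ∀ s, HasDerivAt η (θ s / 2) s := by
  have hd : ∀ s, HasDerivAt (fun s => ∫ u in (1 : ℝ)..s, θ u / 2) (θ s / 2) s := by
    intro s
    have hc : Continuous (fun u => θ u / 2) := hθ.continuous.div_const 2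
    exact intervalIntegral.integral_hasDerivAt_right (hc.intervalIntegrable _ _)
      (hc.stronglyMeasurableAtFilter _ _) hc.continuousAt
  refine ⟨fun s => ∫ u in (1 : ℝ)..s, θ u / 2, ?_, ?_, hd⟩
  · rw [contDiff_infty_iff_deriv]
    refine ⟨fun s => (hd s).differentiableAt, ?_⟩
    have : deriv (fun s => ∫ u in (1 : ℝ)..s, θ u / 2) = fun s => θ s / 2 :=
      funext fun s => (hd s).deriv
    rw [this]
    exact hθ.div_const 2
  · intro s hs
    beta_reduce
    rw [intervalIntegral.integral_congr (g := fun _ => (0 : ℝ))]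
    · simp
    · intro u hu
      rw [uIcc_of_le hs] at hu
      simp [h0 u hu.1]

theorem radial_supp {n : ℕ} {θ : ℝ → ℝ} (h0 : ∀ s, 1 ≤ s → θ s = 0)
    (y : EuclideanSpace ℝ (Fin n)) (hy : 1 ≤ ‖y‖) : θ (‖y‖ ^ 2) = 0 :=
  h0 _ (one_le_pow₀ hy)

theorem radial_compact {n : ℕ} {Θ : EuclideanSpace ℝ (Fin n) → ℝ}
    (h0 : ∀ y, 1 ≤ ‖y‖ → Θ y = 0) : HasCompactSupport Θ := by
  refine HasCompactSupport.intro (isCompact_closedBall (0 : EuclideanSpace ℝ (Fin n)) 1) ?_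
  intro y hy
  apply h0
  simp only [Metric.mem_closedBall, dist_zero_right, not_le] at hy
  exact hy.le

theorem radial_smooth {n : ℕ} {θ : ℝ → ℝ} (hθ : ContDiff ℝ ∞ θ) :
    ContDiff ℝ ∞ (fun y : EuclideanSpace ℝ (Fin n) => θ (‖y‖ ^ 2)) :=
  hθ.comp (contDiff_norm_sq ℝ)

theorem radial_rel {n : ℕ} {θ η : ℝ → ℝ} (hd : ∀ s, HasDerivAt η (θ s / 2) s)
    (y : EuclideanSpace ℝ (Fin n)) (i : Fin n) :
    y i * θ (‖y‖ ^ 2) =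
      fderiv ℝ (fun y : EuclideanSpace ℝ (Fin n) => η (‖y‖ ^ 2)) y (EuclideanSpace.single i 1) := by
  have h1 : HasFDerivAt (fun y : EuclideanSpace ℝ (Fin n) => ‖y‖ ^ 2)
      (2 • (innerSL ℝ y)) y := (hasStrictFDerivAt_norm_sq y).hasFDerivAt
  have h2 := (hd (‖y‖ ^ 2)).comp_hasFDerivAt y h1
  have h3 : HasFDerivAt (fun y : EuclideanSpace ℝ (Fin n) => η (‖y‖ ^ 2))
    ((θ (‖y‖ ^ 2) / 2) • (2 • (innerSL ℝ y))) y := h2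
  rw [h3.fderiv]
  simp [EuclideanSpace.inner_single_right]
  ring

theorem kernels (n : ℕ) : ∃ Θ Θ1 Θ2 : EuclideanSpace ℝ (Fin n) → ℝ,
    (ContDiff ℝ ∞ Θ ∧ ContDiff ℝ ∞ Θ1 ∧ ContDiff ℝ ∞ Θ2) ∧
    ((∀ y, 1 ≤ ‖y‖ → Θ y = 0) ∧ (∀ y, 1 ≤ ‖y‖ → Θ1 y = 0) ∧ (∀ y, 1 ≤ ‖y‖ → Θ2 y = 0)) ∧
    (∀ y i, y i * Θ y = fderiv ℝ Θ1 y (EuclideanSpace.single i 1)) ∧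
    (∀ y i, y i * Θ1 y = fderiv ℝ Θ2 y (EuclideanSpace.single i 1)) ∧
    0 < ∫ y, Θ y := by
  have hθ : ContDiff ℝ ∞ (fun s : ℝ => Real.smoothTransition (1 - s)) :=
    Real.smoothTransition.contDiff.comp (contDiff_const.sub contDiff_id)
  have h0 : ∀ s : ℝ, 1 ≤ s → Real.smoothTransition (1 - s) = 0 := fun s hs =>
    Real.smoothTransition.zero_of_nonpos (by linarith)
  obtain ⟨η, hη, hη0, hηd⟩ := antider hθ h0
  obtain ⟨ζ, hζ, hζ0, hζd⟩ := antider hη hη0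
  refine ⟨fun y => Real.smoothTransition (1 - ‖y‖ ^ 2), fun y => η (‖y‖ ^ 2),
    fun y => ζ (‖y‖ ^ 2), ⟨radial_smooth hθ, radial_smooth hη, radial_smooth hζ⟩,
    ⟨radial_supp h0, radial_supp hη0, radial_supp hζ0⟩, radial_rel hηd, radial_rel hζd, ?_⟩
  have hs := (radial_smooth (n := n) hθ)
  have hc := radial_compact (n := n) (radial_supp h0)
  refine hs.continuous.integral_pos_of_hasCompactSupport_nonneg_nonzero hc (x := 0) ?_ ?_
  · intro y
    exact Real.smoothTransition.nonneg _
  · simp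

theorem av_congr {n : ℕ} {g g' Θ : EuclideanSpace ℝ (Fin n) → ℝ} {x0 x : EuclideanSpace ℝ (Fin n)}
    {r T t : ℝ} (hg : ∀ z ∈ Metric.ball x0 r, g z = g' z) (hΘ : ∀ y, 1 ≤ ‖y‖ → Θ y = 0)
    (hx : x ∈ Metric.ball x0 (r - T)) (ht0 : 0 ≤ t) (htT : t ≤ T) :
    av ml g Θ t x = av ml g' Θ t x := by
  unfold av
  congr 1
  ext y
  by_cases hy : 1 ≤ ‖y‖
  · simp [hΘ y hy]
  · rw [hg]
    rw [Metric.mem_ball, dist_eq_norm] at hx ⊢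
    have h1 : ‖x - t • y - x0‖ ≤ ‖x - x0‖ + ‖t • y‖ := by
      rw [show x - t • y - x0 = (x - x0) - t • y by abel]
      exact norm_sub_le _ _
    have h2 : ‖t • y‖ ≤ t * 1 := by
      rw [norm_smul, Real.norm_eq_abs, abs_of_nonneg ht0]
      gcongr
      exact (not_le.1 hy).le
    linarith

theorem rep1 {n : ℕ} {h Θ Θ1 : EuclideanSpace ℝ (Fin n) → ℝ}
    (hh : ContDiff ℝ 2 h) (hc : HasCompactSupport h)
    (hΘ : Continuous Θ) (hΘc : HasCompactSupport Θ)
    (hΘ1 : ContDiff ℝ 1 Θ1) (hTOne : HasCompactSupport Θ1)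
    (hrel : ∀ y i, y i * Θ y = fderiv ℝ Θ1 y (EuclideanSpace.single i 1))
    (x : EuclideanSpace ℝ (Fin n)) (T : ℝ) :
    h x * ∫ y, Θ y = av ml h Θ T x + Sv ml (lap h) Θ1 T 1 x := by
  have hcont := (av_cont ml (lap_cont hh) (lap_supp hc) hΘ1.continuous hTOne).comp
    (Continuous.prodMk_right x)
  have := intervalIntegral.integral_eq_sub_of_hasDerivAt (a := 0) (b := T)
    (fun t _ => av_time hh hc hΘ hΘc hΘ1 hTOne hrel x t)
    ((continuous_id.mul hcont).neg.intervalIntegrable _ _)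
  have h0 : av ml h Θ 0 x = h x * ∫ y, Θ y := by
    unfold av
    simp [integral_const_mul]
  rw [h0, intervalIntegral.integral_neg] at this
  have hS : Sv ml (lap h) Θ1 T 1 x = ∫ t in (0 : ℝ)..T, t * av ml (lap h) Θ1 t x := by
    unfold Sv
    simp
  rw [hS]
  linarith

theorem rep2 {n : ℕ} {h Θ Θ1 : EuclideanSpace ℝ (Fin n) → ℝ}
    (hh : ContDiff ℝ 2 h) (hc : HasCompactSupport h)
    (hΘ : Continuous Θ) (hΘc : HasCompactSupport Θ)
    (hΘ1 : ContDiff ℝ 1 Θ1) (hTOne : HasCompactSupport Θ1)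
    (hrel : ∀ y i, y i * Θ y = fderiv ℝ Θ1 y (EuclideanSpace.single i 1))
    (x : EuclideanSpace ℝ (Fin n)) (T : ℝ) :
    Sv ml h Θ T 1 x = T ^ 2 / 2 * av ml h Θ T x + 1 / 2 * Sv ml (lap h) Θ1 T 3 x := by
  have hcont := (av_cont ml (lap_cont hh) (lap_supp hc) hΘ1.continuous hTOne).comp
    (Continuous.prodMk_right x)
  have hcont0 := (av_cont ml hh.continuous hc hΘ hΘc).comp (Continuous.prodMk_right x)
  have hd : ∀ t : ℝ, HasDerivAt (fun t : ℝ => t ^ 2 / 2) t t := by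
    intro t
    have := (hasDerivAt_pow 2 t).div_const 2
    simpa using this
  have := intervalIntegral.integral_mul_deriv_eq_deriv_mul (a := 0) (b := T)
    (u := fun t : ℝ => t ^ 2 / 2) (u' := fun t => t)
    (fun t _ => hd t) (fun t _ => av_time hh hc hΘ hΘc hΘ1 hTOne hrel x t)
    (continuous_id.intervalIntegrable _ _)
    ((continuous_id.mul hcont).neg.intervalIntegrable _ _)
  have e1 : Sv ml h Θ T 1 x = ∫ t in (0 : ℝ)..T, t * av ml h Θ t x := by
    unfold Sv
    simp
  have e2 : ∫ t in (0 : ℝ)..T, t ^ 2 / 2 * -(t * av ml (lap h) Θ1 t x) =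
      -(1 / 2) * Sv ml (lap h) Θ1 T 3 x := by
    unfold Sv
    rw [← intervalIntegral.integral_const_mul]
    congr 1
    ext t
    simp only [smul_eq_mul]
    ring
  rw [e2] at this
  rw [e1]
  simp only [ne_eq, OfNat.ofNat_ne_zero, not_false_eq_true, zero_pow, zero_div, zero_mul,
    sub_zero] at this
  linarith

theorem cutoff {n : ℕ} {Ω : Set (EuclideanSpace ℝ (Fin n))} (hΩ : IsOpen Ω)
    {x0 : EuclideanSpace ℝ (Fin n)} (hx0 : x0 ∈ Ω) :
    ∃ r : ℝ, 0 < r ∧ ∃ χ : EuclideanSpace ℝ (Fin n) → ℝ, ContDiff ℝ ∞ χ ∧ HasCompactSupport χ ∧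
      tsupport χ ⊆ Ω ∧ ∀ z ∈ Metric.ball x0 r, χ z = 1 := by
  obtain ⟨ε, hε, hsub⟩ := Metric.isOpen_iff.1 hΩ x0 hx0
  let χ : ContDiffBump x0 := ⟨ε / 4, ε / 2, by linarith, by linarith⟩
  refine ⟨ε / 4, by linarith, χ, χ.contDiff, χ.hasCompactSupport, ?_, ?_⟩
  · rw [χ.tsupport_eq]
    exact (Metric.closedBall_subset_ball (by show ε / 2 < ε; linarith)).trans hsub
  · intro z hz
    exact χ.one_of_mem_closedBall (Metric.ball_subset_closedBall hz)

theorem cut_smooth {n : ℕ} {Ω : Set (EuclideanSpace ℝ (Fin n))} (hΩ : IsOpen Ω)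
    {χ f : EuclideanSpace ℝ (Fin n) → ℝ} {m : ℕ} (hχ : ContDiff ℝ ∞ χ) (hs : tsupport χ ⊆ Ω)
    (hf : ContDiffOn ℝ m f Ω) : ContDiff ℝ m (fun x => χ x * f x) := by
  rw [contDiff_iff_contDiffAt]
  intro x
  by_cases hx : x ∈ Ω
  · exact (hχ.contDiffAt.of_le (by exact_mod_cast le_top)).mul (hf.contDiffAt (hΩ.mem_nhds hx))
  · have h0 : χ =ᶠ[𝓝 x] fun _ => 0 := notMem_tsupport_iff_eventuallyEq.1 (fun h => hx (hs h))
    refine (contDiffAt_const (c := (0 : ℝ))).congr_of_eventuallyEq ?_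
    filter_upwards [h0] with y hy
    simp [hy]

theorem cut_lap {n : ℕ} {χ f : EuclideanSpace ℝ (Fin n) → ℝ} {x0 z : EuclideanSpace ℝ (Fin n)}
    {r : ℝ} (h1 : ∀ z ∈ Metric.ball x0 r, χ z = 1) (hz : z ∈ Metric.ball x0 r) :
    lap (fun x => χ x * f x) z = lap f z := by
  apply lap_congr
  filter_upwards [Metric.isOpen_ball.mem_nhds hz] with y hy
  simp [h1 y hy]

theorem Sv_congr {n : ℕ} {g g' Θ : EuclideanSpace ℝ (Fin n) → ℝ} {x0 x : EuclideanSpace ℝ (Fin n)}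
    {r T : ℝ} (hT : 0 < T) (j : ℕ) (hg : ∀ z ∈ Metric.ball x0 r, g z = g' z)
    (hΘ : ∀ y, 1 ≤ ‖y‖ → Θ y = 0) (hx : x ∈ Metric.ball x0 (r - T)) :
    Sv ml g Θ T j x = Sv ml g' Θ T j x := by
  unfold Sv
  apply intervalIntegral.integral_congr
  intro t ht
  rw [uIcc_of_le hT.le] at ht
  beta_reduce
  rw [av_congr hg hΘ hx ht.1 ht.2]

theorem reg1 {n : ℕ} {Ω : Set (EuclideanSpace ℝ (Fin n))} (hΩ : IsOpen Ω) (m : ℕ)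
    {f g : EuclideanSpace ℝ (Fin n) → ℝ} (hf : ContDiffOn ℝ 2 f Ω) (hg : ContDiffOn ℝ m g Ω)
    (hfg : ∀ x ∈ Ω, lap f x = g x) : ContDiffOn ℝ (m + 1 : ℕ) f Ω := by
  intro x0 hx0
  apply ContDiffAt.contDiffWithinAt
  obtain ⟨r, hr, χ, hχ, hχc, hχs, hχ1⟩ := cutoff hΩ hx0
  obtain ⟨Θ, Θ1, Θ2, ⟨s0, s1, s2⟩, ⟨z0, z1, z2⟩, r1, r2, hpos⟩ := kernels n
  have hsub : Metric.ball x0 r ⊆ Ω := fun z hz =>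
    hχs (subset_tsupport _ (by simp [hχ1 z hz]))
  have hF : ContDiff ℝ 2 (fun x => χ x * f x) := cut_smooth (m := 2) hΩ hχ hχs hf
  have hFc : HasCompactSupport (fun x => χ x * f x) := hχc.mul_right
  have hG : ContDiff ℝ m (fun x => χ x * g x) := cut_smooth hΩ hχ hχs hg
  have hGc : HasCompactSupport (fun x => χ x * g x) := hχc.mul_right
  have hT : 0 < r / 2 := by linarith
  have c0 := radial_compact z0
  have c1 := radial_compact z1
  have hA : ContDiff ℝ (m + 1 : ℕ) (av ml (fun x => χ x * f x) Θ (r / 2)) :=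
    (av_smooth ml hF.continuous s0 c0 hT.ne').of_le (by exact_mod_cast le_top)
  have hB := Sv_contDiff m 1 hT ml hG hGc s1 c1
  refine ((hA.add hB).mul (contDiff_const (c := (∫ y, Θ y)⁻¹))).contDiffAt.congr_of_eventuallyEq ?_
  filter_upwards [Metric.ball_mem_nhds x0 (show 0 < r - r / 2 by linarith)] with x hx
  have hxr : x ∈ Metric.ball x0 r := Metric.ball_subset_ball (by linarith) hx
  have e1 := rep1 hF hFc s0.continuous c0 (s1.of_le (by simp)) c1 r1 x (r / 2)
  have e2 : Sv ml (lap (fun x => χ x * f x)) Θ1 (r / 2) 1 x =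
      Sv ml (fun x => χ x * g x) Θ1 (r / 2) 1 x := by
    refine Sv_congr hT 1 (fun z hz => ?_) z1 hx
    rw [cut_lap hχ1 hz, hfg z (hsub hz), hχ1 z hz, one_mul]
  rw [e2, hχ1 x hxr, one_mul] at e1
  rw [eq_mul_inv_iff_mul_eq₀ hpos.ne', e1]

theorem nat_le_infty (m : ℕ) : (m : WithTop ℕ∞) ≤ ((⊤ : ℕ∞) : WithTop ℕ∞) := by
  exact_mod_cast (le_top : (m : ℕ∞) ≤ ⊤)

theorem reg2 {n : ℕ} {Ω : Set (EuclideanSpace ℝ (Fin n))} (hΩ : IsOpen Ω) (m : ℕ)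
    {f g h : EuclideanSpace ℝ (Fin n) → ℝ} (hf : ContDiffOn ℝ 2 f Ω) (hg : ContDiffOn ℝ 2 g Ω)
    (hh : ContDiffOn ℝ m h Ω)
    (hfg : ∀ x ∈ Ω, lap f x = g x) (hgh : ∀ x ∈ Ω, lap g x = h x) :
    ContDiffOn ℝ (m + 3 : ℕ) f Ω := by
  intro x0 hx0
  apply ContDiffAt.contDiffWithinAt
  obtain ⟨r, hr, χ, hχ, hχc, hχs, hχ1⟩ := cutoff hΩ hx0
  obtain ⟨Θ, Θ1, Θ2, ⟨s0, s1, s2⟩, ⟨z0, z1, z2⟩, r1, r2, hpos⟩ := kernels n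
  have hsub : Metric.ball x0 r ⊆ Ω := fun z hz =>
    hχs (subset_tsupport _ (by simp [hχ1 z hz]))
  have hF : ContDiff ℝ 2 (fun x => χ x * f x) := cut_smooth (m := 2) hΩ hχ hχs hf
  have hFc : HasCompactSupport (fun x => χ x * f x) := hχc.mul_right
  have hG : ContDiff ℝ 2 (fun x => χ x * g x) := cut_smooth (m := 2) hΩ hχ hχs hg
  have hGc : HasCompactSupport (fun x => χ x * g x) := hχc.mul_right
  have hH : ContDiff ℝ m (fun x => χ x * h x) := cut_smooth hΩ hχ hχs hh
  have hHc : HasCompactSupport (fun x => χ x * h x) := hχc.mul_right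
  have hT : 0 < r / 2 := by linarith
  have c0 := radial_compact z0
  have c1 := radial_compact z1
  have c2 := radial_compact z2
  have hA : ContDiff ℝ (m + 3 : ℕ) (av ml (fun x => χ x * f x) Θ (r / 2)) :=
    (av_smooth ml hF.continuous s0 c0 hT.ne').of_le (nat_le_infty (m + 3))
  have hA1 : ContDiff ℝ (m + 3 : ℕ) (av ml (fun x => χ x * g x) Θ1 (r / 2)) :=
    (av_smooth ml hG.continuous s1 c1 hT.ne').of_le (nat_le_infty (m + 3))
  have hB := Sv_contDiff m 3 hT ml hH hHc s2 c2
  refine ((hA.add (((contDiff_const (c := (r / 2) ^ 2 / 2)).mul hA1).add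
    ((contDiff_const (c := 1 / 2)).mul hB))).mul
    (contDiff_const (c := (∫ y, Θ y)⁻¹))).contDiffAt.congr_of_eventuallyEq ?_
  filter_upwards [Metric.ball_mem_nhds x0 (show 0 < r - r / 2 by linarith)] with x hx
  have hxr : x ∈ Metric.ball x0 r := Metric.ball_subset_ball (by linarith) hx
  have e1 := rep1 hF hFc s0.continuous c0 (s1.of_le (by simp)) c1 r1 x (r / 2)
  have e2 : Sv ml (lap (fun x => χ x * f x)) Θ1 (r / 2) 1 x =
      Sv ml (fun x => χ x * g x) Θ1 (r / 2) 1 x := by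
    refine Sv_congr hT 1 (fun z hz => ?_) z1 hx
    rw [cut_lap hχ1 hz, hfg z (hsub hz), hχ1 z hz, one_mul]
  have e3 := rep2 hG hGc s1.continuous c1 (s2.of_le (by simp)) c2 r2 x (r / 2)
  have e4 : Sv ml (lap (fun x => χ x * g x)) Θ2 (r / 2) 3 x =
      Sv ml (fun x => χ x * h x) Θ2 (r / 2) 3 x := by
    refine Sv_congr hT 3 (fun z hz => ?_) z2 hx
    rw [cut_lap hχ1 hz, hgh z (hsub hz), hχ1 z hz, one_mul]
  rw [e2, e3, e4, hχ1 x hxr, one_mul] at e1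
  rw [eq_mul_inv_iff_mul_eq₀ hpos.ne', e1]

theorem no_max {n : ℕ} {z : EuclideanSpace ℝ (Fin n) → ℝ} {x : EuclideanSpace ℝ (Fin n)}
    (hz : ContDiffAt ℝ 2 z x) (hm : IsLocalMax z x) : lap z x ≤ 0 := by
  unfold lap
  refine Finset.sum_nonpos fun i _ => ?_
  by_contra hcon
  push Not at hcon
  set e : EuclideanSpace ℝ (Fin n) := EuclideanSpace.single i 1 with he
  have hline : ∀ s : ℝ, HasDerivAt (fun s : ℝ => x + s • e) e s := by
    intro s
    simpa using ((hasDerivAt_id s).smul_const e).const_add x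
  have hct : Tendsto (fun s : ℝ => x + s • e) (𝓝 0) (𝓝 x) := by
    have : Continuous (fun s : ℝ => x + s • e) := by fun_prop
    simpa using this.tendsto 0
  have hev : ∀ᶠ y in 𝓝 x, ContDiffAt ℝ 2 z y := hz.eventually (by simp)
  have hd1 : ∀ᶠ s in 𝓝 (0 : ℝ), HasDerivAt (fun s : ℝ => z (x + s • e)) (fderiv ℝ z (x + s • e) e) s := by
    filter_upwards [hct.eventually hev] with s hs
    exact (hs.differentiableAt (by norm_num)).hasFDerivAt.comp_hasDerivAt s (hline s)
  have hk : ContDiffAt ℝ 1 (fun y => fderiv ℝ z y e) x :=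
    (hz.fderiv_right (m := 1) (by norm_num)).clm_apply contDiffAt_const
  have hd2 : HasDerivAt (fun s : ℝ => fderiv ℝ z (x + s • e) e)
      (fderiv ℝ (fun y => fderiv ℝ z y e) x e) 0 := by
    have h1 : HasFDerivAt (fun y => fderiv ℝ z y e) (fderiv ℝ (fun y => fderiv ℝ z y e) x)
      (x + (0 : ℝ) • e) := by
      simpa using (hk.differentiableAt (by norm_num)).hasFDerivAt
    exact h1.comp_hasDerivAt (0 : ℝ) (hline 0)
  have hde : deriv (fun s : ℝ => z (x + s • e)) =ᶠ[𝓝 0] fun s : ℝ => fderiv ℝ z (x + s • e) e := by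
    filter_upwards [hd1] with s hs using hs.deriv
  have hdd : deriv (deriv (fun s : ℝ => z (x + s • e))) 0 = fderiv ℝ (fun y => fderiv ℝ z y e) x e := by
    rw [hde.deriv_eq, hd2.deriv]
  have hmax : IsLocalMax (fun s : ℝ => z (x + s • e)) 0 := by
    have := hct.eventually hm
    filter_upwards [this] with s hs
    simpa using hs
  have hmin := isLocalMin_of_deriv_deriv_pos (f := fun s : ℝ => z (x + s • e)) (x₀ := 0)
    (by rw [hdd]; exact hcon) hmax.deriv_eq_zero hd1.self_of_nhds.continuousAt
  have hcst : (fun s : ℝ => z (x + s • e)) =ᶠ[𝓝 0] fun _ => z (x + (0 : ℝ) • e) := by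
    filter_upwards [hmax, hmin] with s h1 h2 using le_antisymm h1 h2
  have : deriv (deriv (fun s : ℝ => z (x + s • e))) 0 = 0 := by
    rw [hcst.deriv.deriv_eq]
    simp
  linarith

theorem lap_barrier {n : ℕ} {w : EuclideanSpace ℝ (Fin n) → ℝ} {x c : EuclideanSpace ℝ (Fin n)}
    (hw : ContDiffAt ℝ 2 w x) (a : ℝ) :
    lap (fun y => w y + a * ‖y - c‖ ^ 2) x = lap w x + a * (2 * n) := by
  have hq : ∀ y, HasFDerivAt (fun y : EuclideanSpace ℝ (Fin n) => a * ‖y - c‖ ^ 2)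
      (a • (2 • innerSL ℝ (y - c))) y := by
    intro y
    have h1 : HasFDerivAt (fun y : EuclideanSpace ℝ (Fin n) => ‖y‖ ^ 2)
      (2 • (innerSL ℝ (y - c))) (y - c) := (hasStrictFDerivAt_norm_sq (y - c)).hasFDerivAt
    have h2 := h1.comp y ((hasFDerivAt_id y).sub_const c)
    exact h2.const_mul a
  have hev : ∀ᶠ y in 𝓝 x, ContDiffAt ℝ 2 w y := hw.eventually (by simp)
  have key : ∀ i : Fin n, fderiv ℝ (fun y => fderiv ℝ (fun y => w y + a * ‖y - c‖ ^ 2) y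
      (EuclideanSpace.single i 1)) x (EuclideanSpace.single i 1) =
      fderiv ℝ (fun y => fderiv ℝ w y (EuclideanSpace.single i 1)) x (EuclideanSpace.single i 1)
        + a * 2 := by
    intro i
    set e : EuclideanSpace ℝ (Fin n) := EuclideanSpace.single i 1 with he
    have h1 : (fun y => fderiv ℝ (fun y => w y + a * ‖y - c‖ ^ 2) y e) =ᶠ[𝓝 x]
        fun y => fderiv ℝ w y e + a * 2 * (y i - c i) := by
      filter_upwards [hev] with y hy
      rw [((hy.differentiableAt (by norm_num)).hasFDerivAt.fun_add (hq y)).fderiv]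
      simp [he, EuclideanSpace.inner_single_right]
      ring
    have hk : ContDiffAt ℝ 1 (fun y => fderiv ℝ w y e) x :=
      (hw.fderiv_right (m := 1) (by norm_num)).clm_apply contDiffAt_const
    have hp : HasFDerivAt (fun y : EuclideanSpace ℝ (Fin n) => a * 2 * (y i - c i))
        ((a * 2) • (EuclideanSpace.proj i : EuclideanSpace ℝ (Fin n) →L[ℝ] ℝ)) x :=
      (((EuclideanSpace.proj i : EuclideanSpace ℝ (Fin n) →L[ℝ] ℝ).hasFDerivAt).sub_const
        (c i)).const_mul (a * 2)
    rw [h1.fderiv_eq, ((hk.differentiableAt (by norm_num)).hasFDerivAt.fun_add hp).fderiv]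
    simp [he]
  unfold lap
  rw [Finset.sum_congr rfl fun i _ => key i, Finset.sum_add_distrib]
  simp
  ring

theorem lap_neg {n : ℕ} (w : EuclideanSpace ℝ (Fin n) → ℝ) (x : EuclideanSpace ℝ (Fin n)) :
    lap (fun y => - w y) x = - lap w x := by
  unfold lap
  simp [fderiv_fun_neg]

theorem maxp1 {n : ℕ} (hn : 2 ≤ n) {Ω : Set (EuclideanSpace ℝ (Fin n))} (hΩ : IsOpen Ω)
    {R : ℝ} {c : EuclideanSpace ℝ (Fin n)} (hball : Ω ⊆ Metric.closedBall c R)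
    {w : EuclideanSpace ℝ (Fin n) → ℝ} (hwc : ContinuousOn w (closure Ω))
    (hw : ContDiffOn ℝ 2 w Ω) (hb : ∀ x ∈ frontier Ω, w x = 0) {K : ℝ} (hK : 0 ≤ K)
    (hl : ∀ x ∈ Ω, -K ≤ lap w x) (x : EuclideanSpace ℝ (Fin n)) (hx : x ∈ Ω) :
    w x ≤ R ^ 2 / (2 * n) * K := by
  have hn0 : (0 : ℝ) < 2 * n := by positivity
  have hcl : closure Ω ⊆ Metric.closedBall c R := closure_minimal hball Metric.isClosed_closedBall
  have hcomp : IsCompact (closure Ω) :=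
    (isCompact_closedBall c R).of_isClosed_subset isClosed_closure hcl
  have main : ∀ ε > 0, w x ≤ (K + ε) / (2 * n) * R ^ 2 := by
    intro ε hε
    set a : ℝ := (K + ε) / (2 * n) with ha
    have ha0 : 0 ≤ a := by positivity
    have hzc : ContinuousOn (fun y => w y + a * ‖y - c‖ ^ 2) (closure Ω) :=
      hwc.add (Continuous.continuousOn (by fun_prop))
    obtain ⟨p, hp, hpm⟩ := hcomp.exists_isMaxOn ⟨x, subset_closure hx⟩ hzc
    have hpΩ : p ∉ Ω := by
      intro hpΩ
      have hloc : IsLocalMax (fun y => w y + a * ‖y - c‖ ^ 2) p :=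
        (hpm.on_subset subset_closure).isLocalMax (hΩ.mem_nhds hpΩ)
      have hwp : ContDiffAt ℝ 2 w p := hw.contDiffAt (hΩ.mem_nhds hpΩ)
      have hz2 : ContDiffAt ℝ 2 (fun y => w y + a * ‖y - c‖ ^ 2) p :=
        hwp.add (contDiffAt_const.mul ((contDiffAt_id.sub contDiffAt_const).norm_sq ℝ))
      have h1 := no_max hz2 hloc
      rw [lap_barrier hwp, ha, div_mul_cancel₀ _ hn0.ne'] at h1
      have := hl p hpΩ
      linarith
    have hpf : p ∈ frontier Ω := ⟨hp, by rwa [hΩ.interior_eq]⟩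
    have h2 : w x + a * ‖x - c‖ ^ 2 ≤ w p + a * ‖p - c‖ ^ 2 := hpm (subset_closure hx)
    rw [hb p hpf] at h2
    have h3 : ‖p - c‖ ≤ R := by
      have := hcl hp
      rwa [Metric.mem_closedBall, dist_eq_norm] at this
    have h4 : a * ‖p - c‖ ^ 2 ≤ a * R ^ 2 := by gcongr
    have h5 : 0 ≤ a * ‖x - c‖ ^ 2 := by positivity
    linarith
  have hlim : Tendsto (fun ε : ℝ => (K + ε) / (2 * n) * R ^ 2) (𝓝[>] 0)
      (𝓝 ((K + 0) / (2 * n) * R ^ 2)) := by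
    have : Continuous (fun ε : ℝ => (K + ε) / (2 * n) * R ^ 2) := by fun_prop
    exact (this.tendsto 0).mono_left nhdsWithin_le_nhds
  have := ge_of_tendsto hlim (by filter_upwards [self_mem_nhdsWithin] with ε hε using main ε hε)
  calc w x ≤ _ := this
    _ = R ^ 2 / (2 * n) * K := by ring

theorem maxp {n : ℕ} (hn : 2 ≤ n) {Ω : Set (EuclideanSpace ℝ (Fin n))} (hΩ : IsOpen Ω)
    {R : ℝ} {c : EuclideanSpace ℝ (Fin n)} (hball : Ω ⊆ Metric.closedBall c R)
    {w φ : EuclideanSpace ℝ (Fin n) → ℝ} (h : IsPoissonSol Ω w φ) {K : ℝ} (hK : 0 ≤ K)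
    (hl : ∀ x ∈ Ω, |φ x| ≤ K) (x : EuclideanSpace ℝ (Fin n)) (hx : x ∈ Ω) :
    |w x| ≤ R ^ 2 / (2 * n) * K := by
  obtain ⟨h1, h2, h3, h4⟩ := h
  rw [abs_le']
  constructor
  · refine maxp1 hn hΩ hball h1 h2 h4 hK (fun y hy => ?_) x hx
    rw [h3 y hy]
    exact (abs_le.1 (hl y hy)).1
  · refine maxp1 (w := fun y => - w y) hn hΩ hball h1.neg h2.neg (fun y hy => by simp [h4 y hy]) hK
      (fun y hy => ?_) x hx
    rw [lap_neg, h3 y hy]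
    exact neg_le_neg (abs_le.1 (hl y hy)).2

end Reg

/-- Proposition 2, regularity of the iterates: if `f` has all continuous
partial derivatives up to order six on `D_M` and conditions (i)–(iii) of the existence
theorem hold, then the iterates of the continuous iterative method satisfy
`w_k ∈ C⁶(Ω)`, `v_k ∈ C⁸(Ω)`, `u_k ∈ C¹⁰(Ω)` for every `k ≥ 0`. -/
theorem statement12 {n : ℕ} (hn : 2 ≤ n)
    (Ω : Set (EuclideanSpace ℝ (Fin n))) (hΩopen : IsOpen Ω) (hΩconn : IsConnected Ω)
    (R : ℝ) (c : EuclideanSpace ℝ (Fin n)) (hball : Ω ⊆ Metric.closedBall c R)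
    (CΩ : ℝ) (hCΩ : CΩ = R ^ 2 / (2 * n))
    (f : EuclideanSpace ℝ (Fin n) → ℝ → ℝ → ℝ → ℝ)
    (hf : ContinuousOn (fun p : EuclideanSpace ℝ (Fin n) × ℝ × ℝ × ℝ =>
      f p.1 p.2.1 p.2.2.1 p.2.2.2)
      ((closure Ω) ×ˢ (Set.univ : Set (ℝ × ℝ × ℝ))))
    (M L1 L2 L3 : ℝ) (hM : 0 < M) (hL1 : 0 ≤ L1) (hL2 : 0 ≤ L2) (hL3 : 0 ≤ L3)
    -- `f` has all continuous partial derivatives up to order six on `D_M`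
    (hfsmooth : ContDiffOn ℝ 6
      (fun p : EuclideanSpace ℝ (Fin n) × ℝ × ℝ × ℝ => f p.1 p.2.1 p.2.2.1 p.2.2.2)
      {p : EuclideanSpace ℝ (Fin n) × ℝ × ℝ × ℝ | p.1 ∈ Ω ∧
        |p.2.1| ≤ CΩ ^ 3 * M ∧ |p.2.2.1| ≤ CΩ ^ 2 * M ∧ |p.2.2.2| ≤ CΩ * M})
    -- (i) boundedness of `f` on `D_M`
    (hbound : ∀ x ∈ Ω, ∀ u v w : ℝ,
      |u| ≤ CΩ ^ 3 * M → |v| ≤ CΩ ^ 2 * M → |w| ≤ CΩ * M → |f x u v w| ≤ M)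
    -- (ii) Lipschitz condition on `D_M`
    (hlip : ∀ x ∈ Ω, ∀ u₁ v₁ w₁ u₂ v₂ w₂ : ℝ,
      |u₁| ≤ CΩ ^ 3 * M → |v₁| ≤ CΩ ^ 2 * M → |w₁| ≤ CΩ * M →
      |u₂| ≤ CΩ ^ 3 * M → |v₂| ≤ CΩ ^ 2 * M → |w₂| ≤ CΩ * M →
      |f x u₂ v₂ w₂ - f x u₁ v₁ w₁| ≤ L1 * |u₂ - u₁| + L2 * |v₂ - v₁| + L3 * |w₂ - w₁|)
    -- (iii) contraction condition
    (hq : (CΩ ^ 2 * L1 + CΩ * L2 + L3) * CΩ < 1)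
    -- the continuous iterative method
    (φs ws vs us : ℕ → EuclideanSpace ℝ (Fin n) → ℝ)
    (hφ0 : ∀ x ∈ closure Ω, φs 0 x = f x 0 0 0)
    (hW : ∀ k : ℕ, IsPoissonSol Ω (ws k) (φs k))
    (hV : ∀ k : ℕ, IsPoissonSol Ω (vs k) (ws k))
    (hU : ∀ k : ℕ, IsPoissonSol Ω (us k) (vs k))
    (hupd : ∀ k : ℕ, ∀ x ∈ closure Ω, φs (k + 1) x = f x (us k x) (vs k x) (ws k x)) :
    ∀ k : ℕ, ContDiffOn ℝ 6 (ws k) Ω ∧ ContDiffOn ℝ 8 (vs k) Ω ∧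
      ContDiffOn ℝ 10 (us k) Ω := by
  have hC0 : 0 ≤ CΩ := by rw [hCΩ]; positivity
  -- bounds from bounds on `φ`
  have bnd : ∀ k, (∀ x ∈ Ω, |φs k x| ≤ M) → ∀ x ∈ Ω,
      |us k x| ≤ CΩ ^ 3 * M ∧ |vs k x| ≤ CΩ ^ 2 * M ∧ |ws k x| ≤ CΩ * M := by
    intro k hk x hx
    have b1 : ∀ x ∈ Ω, |ws k x| ≤ CΩ * M := by
      rw [hCΩ]
      exact maxp hn hΩopen hball (hW k) hM.le hk
    have b2 : ∀ x ∈ Ω, |vs k x| ≤ CΩ * (CΩ * M) := by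
      have := maxp hn hΩopen hball (hV k) (mul_nonneg hC0 hM.le) b1
      rwa [← hCΩ] at this
    have b3 : ∀ x ∈ Ω, |us k x| ≤ CΩ * (CΩ * (CΩ * M)) := by
      have := maxp hn hΩopen hball (hU k) (mul_nonneg hC0 (mul_nonneg hC0 hM.le)) b2
      rwa [← hCΩ] at this
    exact ⟨(b3 x hx).trans_eq (by ring), (b2 x hx).trans_eq (by ring), b1 x hx⟩
  have hφb : ∀ k, ∀ x ∈ Ω, |φs k x| ≤ M := by
    intro k
    induction k with
    | zero =>
      intro x hx
      rw [hφ0 x (subset_closure hx)]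
      refine hbound x hx 0 0 0 ?_ ?_ ?_ <;> rw [abs_zero] <;> positivity
    | succ k ih =>
      intro x hx
      rw [hupd k x (subset_closure hx)]
      obtain ⟨h1, h2, h3⟩ := bnd k ih x hx
      exact hbound x hx _ _ _ h1 h2 h3
  -- regularity from regularity of `φ`
  have reg : ∀ k, ContDiffOn ℝ 6 (φs k) Ω → ContDiffOn ℝ 7 (ws k) Ω ∧ ContDiffOn ℝ 8 (vs k) Ω ∧
      ContDiffOn ℝ 10 (us k) Ω := by
    intro k hk
    have r1 : ContDiffOn ℝ (7 : ℕ) (ws k) Ω :=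
      reg1 hΩopen 6 (hW k).2.1 (by exact_mod_cast hk) (hW k).2.2.1
    have r2 : ContDiffOn ℝ (8 : ℕ) (vs k) Ω := reg1 hΩopen 7 (hV k).2.1 r1 (hV k).2.2.1
    have r3 : ContDiffOn ℝ (10 : ℕ) (us k) Ω :=
      reg2 hΩopen 7 (hU k).2.1 (hV k).2.1 r1 (hU k).2.2.1 (hV k).2.2.1
    exact ⟨by exact_mod_cast r1, by exact_mod_cast r2, by exact_mod_cast r3⟩
  have hφr : ∀ k, ContDiffOn ℝ 6 (φs k) Ω := by
    intro k
    induction k with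
    | zero =>
      have h1 : ContDiffOn ℝ 6 (fun x : EuclideanSpace ℝ (Fin n) =>
          ((x, 0, 0, 0) : EuclideanSpace ℝ (Fin n) × ℝ × ℝ × ℝ)) Ω :=
        contDiffOn_id.prodMk (contDiffOn_const.prodMk (contDiffOn_const.prodMk contDiffOn_const))
      refine (hfsmooth.comp h1 ?_).congr ?_
      · intro x hx
        refine ⟨hx, ?_, ?_, ?_⟩ <;> simp only [abs_zero] <;> positivity
      · intro x hx
        exact hφ0 x (subset_closure hx)
    | succ k ih =>
      obtain ⟨r1, r2, r3⟩ := reg k ih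
      have h1 : ContDiffOn ℝ 6 (fun x : EuclideanSpace ℝ (Fin n) =>
          ((x, us k x, vs k x, ws k x) : EuclideanSpace ℝ (Fin n) × ℝ × ℝ × ℝ)) Ω :=
        contDiffOn_id.prodMk ((r3.of_le (by norm_num)).prodMk
          ((r2.of_le (by norm_num)).prodMk (r1.of_le (by norm_num))))
      refine (hfsmooth.comp h1 ?_).congr ?_
      · intro x hx
        exact ⟨hx, bnd k (hφb k) x hx⟩
      · intro x hx
        exact hupd k x (subset_closure hx)
  intro k
  obtain ⟨r1, r2, r3⟩ := reg k (hφr k)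
  exact ⟨r1.of_le (by norm_num), r2, r3⟩
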